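/- arXiv:1701.01002 — 3 statements merged into one kernel-verified Lean document; each statement's English description precedes it below -/
import Mathlib

section
/- The copolar map sends nonempty members of C₊ exactly onto the members of C₋ other than R̄₋ⁿ: (i) for every nonempty A ∈ C₊, the copolar A° belongs to C₋ (it is closed, convex, contained in R̄₋ⁿ, and satisfies A° + R₋ⁿ ⊆ A°) and A° ≠ R̄₋ⁿ; (ii) conversely, for every B ∈ C₋ with B ≠ R̄₋ⁿ there exists a nonempty A ∈ C₊ with A° = B. -/
open Set MeasureTheory Pointwise

noncomputable section

abbrev En (n : ℕ) := EuclideanSpace ℝ (Fin n)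

/-- Standard inner product on ℝⁿ. -/
def dotp {n : ℕ} (x y : En n) : ℝ := ∑ i, x i * y i

/-- Closed positive orthant R̄₊ⁿ. -/
def posOrthantCl (n : ℕ) : Set (En n) := {x | ∀ i, 0 ≤ x i}
/-- Open positive orthant R₊ⁿ. -/
def posOrthantOp (n : ℕ) : Set (En n) := {x | ∀ i, 0 < x i}
/-- Closed negative orthant R̄₋ⁿ. -/
def negOrthantCl (n : ℕ) : Set (En n) := {x | ∀ i, x i ≤ 0}
/-- Open negative orthant R₋ⁿ. -/
def negOrthantOp (n : ℕ) : Set (En n) := {x | ∀ i, x i < 0}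

/-- Copolar A° = {x : ⟨x,y⟩ ≤ −1 for all y ∈ A}. -/
def copolar {n : ℕ} (A : Set (En n)) : Set (En n) := {x | ∀ y ∈ A, dotp x y ≤ -1}

/-- Membership in C₊: closed convex subset of R̄₊ⁿ with A + R₊ⁿ ⊆ A. -/
def memCplus {n : ℕ} (A : Set (En n)) : Prop :=
  IsClosed A ∧ Convex ℝ A ∧ A ⊆ posOrthantCl n ∧ A + posOrthantOp n ⊆ A

/-- Membership in C₋: closed convex subset of R̄₋ⁿ with A + R₋ⁿ ⊆ A. -/
def memCminus {n : ℕ} (A : Set (En n)) : Prop :=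
  IsClosed A ∧ Convex ℝ A ∧ A ⊆ negOrthantCl n ∧ A + negOrthantOp n ⊆ A

/-- Membership in CC₊: member of C₊ with bounded complement in R̄₊ⁿ. -/
def memCCplus {n : ℕ} (P : Set (En n)) : Prop :=
  memCplus P ∧ Bornology.IsBounded (posOrthantCl n \ P)

/-- Membership in UC₋: nonempty member of C₋ contained in s* + R̄₋ⁿ for some s* ∈ R₋ⁿ. -/
def memUCminus {n : ℕ} (L : Set (En n)) : Prop :=
  L.Nonempty ∧ memCminus L ∧ ∃ s ∈ negOrthantOp n, L ⊆ s +ᵥ negOrthantCl n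

/-- Support function of a set, with values in EReal. -/
def suppFn {n : ℕ} (A : Set (En n)) (x : En n) : EReal := ⨆ y ∈ A, ((dotp x y : ℝ) : EReal)

/-- Legendre transform of an EReal-valued function. -/
def legendre {n : ℕ} (f : En n → EReal) (y : En n) : EReal :=
  ⨆ x, ((dotp x y : ℝ) : EReal) - f x

/-- Bridge to Mathlib's inner product. -/
theorem dotp_eq_inner {n : ℕ} (x y : En n) : dotp x y = inner ℝ y x := by
  simp [dotp, PiLp.inner_apply]

theorem dotp_add_right {n : ℕ} (x y z : En n) : dotp x (y + z) = dotp x y + dotp x z := by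
  simp only [dotp_eq_inner, inner_add_left]

theorem dotp_add_left {n : ℕ} (x y z : En n) : dotp (x + y) z = dotp x z + dotp y z := by
  simp only [dotp_eq_inner, inner_add_right]

theorem dotp_smul_right {n : ℕ} (c : ℝ) (x y : En n) : dotp x (c • y) = c * dotp x y := by
  simp only [dotp_eq_inner, real_inner_smul_left]

theorem dotp_smul_left {n : ℕ} (c : ℝ) (x y : En n) : dotp (c • x) y = c * dotp x y := by
  simp only [dotp_eq_inner, real_inner_smul_right]

theorem dotp_comm {n : ℕ} (x y : En n) : dotp x y = dotp y x := by
  simp only [dotp_eq_inner, real_inner_comm]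

theorem dotp_nonpos {n : ℕ} {x y : En n} (hx : ∀ i, x i ≤ 0) (hy : ∀ i, 0 ≤ y i) :
    dotp x y ≤ 0 :=
  Finset.sum_nonpos fun i _ => mul_nonpos_of_nonpos_of_nonneg (hx i) (hy i)

theorem isClosed_copolar {n : ℕ} (A : Set (En n)) : IsClosed (copolar A) := by
  simp only [copolar, ofPred_forall]
  refine isClosed_biInter fun y _ => isClosed_le ?_ continuous_const
  simp only [dotp_eq_inner]
  fun_prop

theorem convex_copolar {n : ℕ} (A : Set (En n)) : Convex ℝ (copolar A) := by
  intro x hx z hz a b ha hb hab y hy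
  rw [dotp_add_left, dotp_smul_left, dotp_smul_left]
  nlinarith [hx y hy, hz y hy]

/-- A linear functional bounded above on a nonempty set absorbing the open positive orthant
has nonpositive coefficients. -/
theorem mem_negOrthantCl_of_dotp_le {n : ℕ} {A : Set (En n)} (hA : A.Nonempty)
    (hAdd : A + posOrthantOp n ⊆ A) {x : En n} {c : ℝ} (h : ∀ y ∈ A, dotp x y ≤ c) :
    x ∈ negOrthantCl n := by
  obtain ⟨a, ha⟩ := hA
  intro i
  by_contra! hi
  set T : ℝ := (|c - dotp x a - ∑ j, x j| + 1) / x i with hT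
  have hT0 : 0 < T := by positivity
  let p : En n := WithLp.toLp 2 fun j => 1 + if j = i then T else 0
  have hp : p ∈ posOrthantOp n := by
    intro j
    change 0 < 1 + if j = i then T else 0
    split_ifs <;> positivity
  have hxp : dotp x p = ∑ j, x j + x i * T := by
    simp [dotp, p, mul_add, Finset.sum_add_distrib]
  have hle := h _ (hAdd (add_mem_add ha hp))
  have hxT : x i * T = |c - dotp x a - ∑ j, x j| + 1 := mul_div_cancel₀ _ hi.ne'
  rw [dotp_add_right, hxp, hxT] at hle
  linarith [le_abs_self (c - dotp x a - ∑ j, x j)]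

theorem mem_posOrthantCl_of_dotp_le {n : ℕ} {B : Set (En n)} (hB : B.Nonempty)
    (hAdd : B + negOrthantOp n ⊆ B) {y : En n} {c : ℝ} (h : ∀ x ∈ B, dotp x y ≤ c) :
    y ∈ posOrthantCl n := by
  have hneg : -y ∈ negOrthantCl n := by
    refine mem_negOrthantCl_of_dotp_le (A := -B) (c := c) hB.neg ?_ fun x hx => ?_
    · rintro _ ⟨x, hx, p, hp, rfl⟩
      refine Set.mem_neg.2 ?_
      rw [neg_add]
      exact hAdd (add_mem_add hx fun i => neg_lt_zero.2 (hp i))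
    · have := h (-x) hx
      rwa [dotp_eq_inner, inner_neg_right, ← inner_neg_left, real_inner_comm,
        ← dotp_eq_inner] at this
  exact fun i => neg_nonpos.1 (hneg i)

theorem memCminus_copolar {n : ℕ} {A : Set (En n)} (hA : memCplus A) (hne : A.Nonempty) :
    memCminus (copolar A) := by
  refine ⟨isClosed_copolar A, convex_copolar A,
    fun x hx => mem_negOrthantCl_of_dotp_le hne hA.2.2.2 hx, ?_⟩
  rintro _ ⟨x, hx, p, hp, rfl⟩ y hy
  rw [dotp_add_left]
  linarith [hx y hy, dotp_nonpos (fun i => (hp i).le) (hA.2.2.1 hy)]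

theorem memCplus_copolar {n : ℕ} {B : Set (En n)} (hB : memCminus B) (hne : B.Nonempty) :
    memCplus (copolar B) := by
  refine ⟨isClosed_copolar B, convex_copolar B, fun y hy =>
    mem_posOrthantCl_of_dotp_le (c := -1) hne hB.2.2.2 fun x hx => dotp_comm x y ▸ hy x hx, ?_⟩
  rintro _ ⟨y, hy, p, hp, rfl⟩ x hx
  rw [dotp_add_left, dotp_comm p x]
  linarith [hy x hx, dotp_nonpos (hB.2.2.1 hx) (fun i => (hp i).le)]

theorem zero_notMem_copolar {n : ℕ} {A : Set (En n)} (hne : A.Nonempty) : 0 ∉ copolar A := by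
  obtain ⟨a, ha⟩ := hne
  intro h
  have := h a ha
  norm_num [dotp] at this

theorem zero_notMem_of_ne {n : ℕ} {B : Set (En n)} (hB : memCminus B)
    (hne : B ≠ negOrthantCl n) : 0 ∉ B := by
  intro h0
  refine hne (hB.2.2.1.antisymm fun x hx => ?_)
  let e : En n := WithLp.toLp 2 fun _ => -1
  have hlim : Filter.Tendsto (fun t : ℝ => x + t • e) (nhdsWithin 0 (Ioi 0)) (nhds x) := by
    have hc : Continuous fun t : ℝ => x + t • e := by fun_prop
    simpa using (hc.tendsto 0).mono_left nhdsWithin_le_nhds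
  refine hB.1.mem_of_tendsto hlim ?_
  filter_upwards [self_mem_nhdsWithin] with t ht
  have hmem : x + t • e ∈ negOrthantOp n := by
    intro i
    have hi := hx i
    have ht : 0 < t := ht
    simp only [PiLp.add_apply, PiLp.smul_apply, smul_eq_mul, e]
    linarith
  simpa using hB.2.2.2 (add_mem_add h0 hmem)

theorem exists_dotp_separation {n : ℕ} {B : Set (En n)} (hcl : IsClosed B) (hco : Convex ℝ B)
    {z : En n} (hz : z ∉ B) :
    ∃ (y : En n) (u : ℝ), (∀ x ∈ B, dotp x y < u) ∧ u < dotp z y := by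
  obtain ⟨f, u, hf, hu⟩ := geometric_hahn_banach_closed_point hco hcl hz
  refine ⟨(InnerProductSpace.toDual ℝ (En n)).symm f, u, fun x hx => ?_, ?_⟩
  · simpa [dotp_eq_inner] using hf x hx
  · simpa [dotp_eq_inner] using hu

theorem mem_copolar_smul {n : ℕ} {B : Set (En n)} {y : En n} {u : ℝ} (hu : u < 0)
    (h : ∀ x ∈ B, dotp x y < u) : (-u)⁻¹ • y ∈ copolar B := by
  intro x hx
  have hpos : 0 < -u := neg_pos.2 hu
  rw [dotp_smul_left, inv_mul_le_iff₀ hpos, dotp_comm]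
  linarith [h x hx]

theorem copolar_nonempty {n : ℕ} {B : Set (En n)} (hcl : IsClosed B) (hco : Convex ℝ B)
    (h0 : 0 ∉ B) : (copolar B).Nonempty := by
  obtain ⟨y, u, hy, hu⟩ := exists_dotp_separation hcl hco h0
  exact ⟨_, mem_copolar_smul (by simpa [dotp] using hu) hy⟩

theorem copolar_copolar {n : ℕ} {B : Set (En n)} (hB : memCminus B) (hne : B.Nonempty)
    (h0 : 0 ∉ B) : copolar (copolar B) = B := by
  refine Subset.antisymm (fun z hz => ?_) fun x hx y hy => dotp_comm x y ▸ hy x hx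
  by_contra hzB
  obtain ⟨y, u, hy, hu⟩ := exists_dotp_separation hB.1 hB.2.1 hzB
  rcases lt_or_ge u 0 with hneg | hnonneg
  · have h := hz _ (mem_copolar_smul hneg hy)
    rw [dotp_smul_right, inv_mul_le_iff₀ (neg_pos.2 hneg)] at h
    linarith
  · obtain ⟨w, hw⟩ := copolar_nonempty hB.1 hB.2.1 h0
    have hypos := mem_posOrthantCl_of_dotp_le hne hB.2.2.2 fun x hx => (hy x hx).le
    have hzy : 0 < dotp z y := hnonneg.trans_lt hu
    set t : ℝ := |dotp z w| / dotp z y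
    have ht : 0 ≤ t := by positivity
    have hmem : w + t • y ∈ copolar B := by
      intro x hx
      rw [dotp_add_left, dotp_smul_left, dotp_comm y x]
      nlinarith [hw x hx, mul_nonneg ht (neg_nonneg.2 (dotp_nonpos (hB.2.2.1 hx) hypos))]
    have h := hz _ hmem
    rw [dotp_add_right, dotp_smul_right, div_mul_cancel₀ _ hzy.ne'] at h
    linarith [neg_abs_le (dotp z w)]

theorem memCplus_posOrthantCl (n : ℕ) : memCplus (posOrthantCl n) := by
  refine ⟨?_, ?_, Subset.rfl, ?_⟩
  · simp only [posOrthantCl, ofPred_forall]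
    exact isClosed_iInter fun i => isClosed_le continuous_const (by fun_prop)
  · intro x hx y hy a b ha hb _ i
    exact add_nonneg (mul_nonneg ha (hx i)) (mul_nonneg hb (hy i))
  · rintro _ ⟨x, hx, p, hp, rfl⟩ i
    exact add_nonneg (hx i) (hp i).le

theorem copolar_posOrthantCl (n : ℕ) : copolar (posOrthantCl n) = ∅ := by
  refine eq_empty_of_forall_notMem fun x hx => ?_
  have := hx 0 fun i => le_rfl
  norm_num [dotp] at this

/-- The copolar map sends nonempty members of C₊ exactly onto the members
of C₋ other than R̄₋ⁿ. -/
theorem copolar_image_Cplus (n : ℕ) (hn : 1 ≤ n) :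
    (∀ A : Set (En n), memCplus A → A.Nonempty →
      memCminus (copolar A) ∧ copolar A ≠ negOrthantCl n) ∧
    (∀ B : Set (En n), memCminus B → B ≠ negOrthantCl n →
      ∃ A : Set (En n), memCplus A ∧ A.Nonempty ∧ copolar A = B) := by
  refine ⟨fun A hA hne => ⟨memCminus_copolar hA hne, fun h => ?_⟩, fun B hB hBne => ?_⟩
  · refine zero_notMem_copolar hne ?_
    rw [h]
    exact fun i => le_rfl
  · rcases B.eq_empty_or_nonempty with rfl | hne
    · exact ⟨posOrthantCl n, memCplus_posOrthantCl n, ⟨0, fun i => le_rfl⟩,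
        copolar_posOrthantCl n⟩
    · have h0 := zero_notMem_of_ne hB hBne
      exact ⟨copolar B, memCplus_copolar hB hne, copolar_nonempty hB.1 hB.2.1 h0,
        copolar_copolar hB hne h0⟩
end
end

section
/- Let β ∈ R₊ⁿ (all coordinates strictly positive) and let P = {a ∈ R̄₊ⁿ : ⟨a,β⟩ ≥ 1} be the corresponding cosimplex. Then its copolar is the translated negative orthant: P° = −β + R̄₋ⁿ = {x ∈ ℝⁿ : xₖ ≤ −βₖ for every k}. -/
open Set MeasureTheory Pointwise

noncomputable section

theorem copolar_cosimplex_eq_setOf {n : ℕ} {β : En n} (hβ : β ∈ posOrthantOp n) :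
    copolar {a ∈ posOrthantCl n | 1 ≤ dotp a β} = {x : En n | ∀ k, x k ≤ -β k} := by
  ext x
  constructor
  · intro hx k
    have hk : 0 < β k := hβ k
    have h := hx (EuclideanSpace.single k (β k)⁻¹) ⟨fun i => ?_, ?_⟩
    · simp only [dotp, PiLp.single_apply, mul_ite, mul_zero, Finset.sum_ite_eq',
        Finset.mem_univ, if_true] at h
      rw [← div_eq_mul_inv, div_le_iff₀ hk] at h
      linarith
    · simp only [PiLp.single_apply]
      split_ifs <;> positivity
    · simp [dotp, PiLp.single_apply, hk.ne']
  · rintro hx a ⟨ha, h1⟩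
    calc dotp x a ≤ ∑ i, -(a i * β i) :=
          Finset.sum_le_sum fun i _ => by nlinarith [mul_le_mul_of_nonneg_right (hx i) (ha i)]
      _ = -dotp a β := Finset.sum_neg_distrib _
      _ ≤ -1 := neg_le_neg h1

theorem vadd_negOrthantCl {n : ℕ} (b : En n) :
    b +ᵥ negOrthantCl n = {x : En n | ∀ k, x k ≤ b k} := by
  ext x
  simp [mem_vadd_set_iff_neg_vadd_mem, negOrthantCl]

/-- For β ∈ R₊ⁿ and the cosimplex P = {a ∈ R̄₊ⁿ : ⟨a,β⟩ ≥ 1}, the copolar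
is the translated negative orthant: P° = −β + R̄₋ⁿ = {x : xₖ ≤ −βₖ for all k}. -/
theorem copolar_cosimplex (n : ℕ) (hn : 1 ≤ n) (β : En n) (hβ : β ∈ posOrthantOp n) :
    copolar {a ∈ posOrthantCl n | 1 ≤ dotp a β} = (-β) +ᵥ negOrthantCl n ∧
    copolar {a ∈ posOrthantCl n | 1 ≤ dotp a β} = {x : En n | ∀ k, x k ≤ -β k} := by
  refine ⟨?_, copolar_cosimplex_eq_setOf hβ⟩
  rw [copolar_cosimplex_eq_setOf hβ, vadd_negOrthantCl]
  rfl
end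
end

section
/- Let M > 0 and let u₀, u₁ : ℝⁿ → (−∞,+∞] be convex lower semicontinuous functions with −M ≤ uⱼ ≤ 0 on R̄₋ⁿ and uⱼ = +∞ on ℝⁿ \ R̄₋ⁿ (j = 0,1). Define W : ℝⁿ × ℝ → (−∞,+∞] by W(x,t) = 𝓛[(1−t)𝓛[u₀] + t𝓛[u₁]](x) for t ∈ [0,1] and W(x,t) = +∞ for t ∉ [0,1]. Then the (n+1)-dimensional Legendre transform of W satisfies, for all a ∈ ℝⁿ and r ∈ ℝ: sup_{(x,t) ∈ ℝⁿ×ℝ} {⟨x,a⟩ + t·r − W(x,t)} = max{𝓛[u₀](a), 𝓛[u₁](a) + r}. -/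
open Set MeasureTheory Pointwise

noncomputable section

/-- Convexity of an EReal-valued function, expressed as convexity of its epigraph. -/
def epiConvex {V : Type*} [AddCommGroup V] [Module ℝ V] (f : V → EReal) : Prop :=
  Convex ℝ {p : V × ℝ | f p.1 ≤ (p.2 : EReal)}

theorem dotp_sub_le_legendre {n : ℕ} (f : En n → EReal) (x y : En n) :
    ((dotp x y : ℝ) : EReal) - f x ≤ legendre f y :=
  le_iSup (fun x => ((dotp x y : ℝ) : EReal) - f x) x

/-- The biconjugate of a function lies below the function wherever the latter is not `⊥`. -/
theorem legendre_legendre_le {n : ℕ} (f : En n → EReal) (x : En n) (hx : f x ≠ ⊥) :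
    legendre (legendre f) x ≤ f x := by
  refine iSup_le fun y => ?_
  have h := dotp_sub_le_legendre f x y
  rw [dotp_comm y x]
  induction hfx : f x with
  | bot => exact absurd hfx hx
  | top => exact le_top
  | coe c =>
    rw [hfx] at h
    induction hL : legendre f y with
    | bot =>
      rw [hL, ← EReal.coe_sub] at h
      exact absurd (le_bot_iff.mp h) (EReal.coe_ne_bot _)
    | top => simp
    | coe d =>
      rw [hL] at h
      norm_cast at h ⊢
      linarith

theorem legendre_nonneg {n : ℕ} (f : En n → EReal) (h0 : f 0 ≤ 0) (y : En n) :
    0 ≤ legendre f y := by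
  refine le_trans ?_ (dotp_sub_le_legendre f 0 y)
  have hd : dotp (0 : En n) y = 0 := by simp [dotp]
  rw [hd, EReal.coe_zero, zero_sub]
  simpa using EReal.neg_le_neg_iff.mpr h0

/-- A function with values in `[-M, 0]` on the closed negative orthant and equal to `⊤` outside
never takes the value `⊥`. -/
theorem ne_bot_of_bounded_on_negOrthantCl {n : ℕ} {M : ℝ} {u : En n → EReal}
    (hb : ∀ x ∈ negOrthantCl n, ((-M : ℝ) : EReal) ≤ u x ∧ u x ≤ 0)
    (ho : ∀ x ∉ negOrthantCl n, u x = ⊤) (x : En n) : u x ≠ ⊥ := by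
  by_cases hx : x ∈ negOrthantCl n
  · exact ne_bot_of_le_ne_bot (EReal.coe_ne_bot _) (hb x hx).1
  · simp [ho x hx]

/-- The (n+1)-dimensional Legendre transform of the geodesic
W(x,t) = 𝓛[(1−t)𝓛[u₀] + t𝓛[u₁]](x) (for t ∈ [0,1], +∞ otherwise) equals
max{𝓛[u₀](a), 𝓛[u₁](a) + r}. -/
theorem legendre_of_toric_geodesic (n : ℕ) (hn : 1 ≤ n) (M : ℝ) (hM : 0 < M)
    (u0 u1 : En n → EReal)
    (hc0 : epiConvex u0) (hc1 : epiConvex u1)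
    (hl0 : LowerSemicontinuous u0) (hl1 : LowerSemicontinuous u1)
    (hb0 : ∀ x ∈ negOrthantCl n, ((-M : ℝ) : EReal) ≤ u0 x ∧ u0 x ≤ 0)
    (hb1 : ∀ x ∈ negOrthantCl n, ((-M : ℝ) : EReal) ≤ u1 x ∧ u1 x ≤ 0)
    (ho0 : ∀ x ∉ negOrthantCl n, u0 x = ⊤)
    (ho1 : ∀ x ∉ negOrthantCl n, u1 x = ⊤)
    (W : En n × ℝ → EReal)
    (hW1 : ∀ x : En n, ∀ t ∈ Set.Icc (0:ℝ) 1, W (x, t) =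
      legendre (fun y => ((1 - t : ℝ) : EReal) * legendre u0 y
        + ((t : ℝ) : EReal) * legendre u1 y) x)
    (hW2 : ∀ x : En n, ∀ t : ℝ, t ∉ Set.Icc (0:ℝ) 1 → W (x, t) = ⊤) :
    ∀ (a : En n) (r : ℝ),
      (⨆ p : En n × ℝ, ((dotp p.1 a + p.2 * r : ℝ) : EReal) - W p)
        = max (legendre u0 a) (legendre u1 a + (r : EReal)) := by
  intro a r
  have hzero : (0 : En n) ∈ negOrthantCl n := fun i => by simp
  have hL0 := legendre_nonneg u0 (hb0 0 hzero).2 a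
  have hL1 := legendre_nonneg u1 (hb1 0 hzero).2 a
  apply le_antisymm
  · refine iSup_le ?_
    rintro ⟨x, t⟩
    by_cases ht : t ∈ Set.Icc (0 : ℝ) 1
    · have hW := dotp_sub_le_legendre (fun y => ((1 - t : ℝ) : EReal) * legendre u0 y
        + ((t : ℝ) : EReal) * legendre u1 y) a x
      rw [← hW1 x t ht] at hW
      induction hA : legendre u0 a with
      | bot => simp [hA] at hL0
      | top => simp
      | coe A =>
        induction hB : legendre u1 a with
        | bot => simp [hB] at hL1
        | top => simp
        | coe B =>
          simp only [hA, hB] at hW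
          have hconv : (1 - t) * A + t * (B + r) ≤ max A (B + r) := by
            have h0 := mul_le_mul_of_nonneg_left (le_max_left A (B + r)) (sub_nonneg.mpr ht.2)
            have h1 := mul_le_mul_of_nonneg_left (le_max_right A (B + r)) ht.1
            linarith
          rw [← EReal.coe_add, ← EReal.coe_strictMono.monotone.map_max]
          refine (EReal.sub_le_sub le_rfl hW).trans ?_
          norm_cast
          rw [dotp_comm x a]
          linarith
    · simp [hW2 x t ht]
  · refine max_le (iSup_le fun x => ?_) ?_
    · refine le_trans ?_ (le_iSup _ (x, (0 : ℝ)))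
      have hW : W (x, 0) ≤ u0 x := by
        rw [hW1 x 0 (by simp)]
        simpa using legendre_legendre_le u0 x (ne_bot_of_bounded_on_negOrthantCl hb0 ho0 x)
      simpa using EReal.sub_le_sub le_rfl hW
    · rw [← EReal.le_sub_iff_add_le (by simp) (by simp)]
      refine iSup_le fun x => ?_
      rw [EReal.le_sub_iff_add_le (by simp) (by simp)]
      refine le_trans ?_ (le_iSup _ (x, (1 : ℝ)))
      have hW : W (x, 1) ≤ u1 x := by
        rw [hW1 x 1 (by simp)]
        simpa using legendre_legendre_le u1 x (ne_bot_of_bounded_on_negOrthantCl hb1 ho1 x)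
      refine le_trans (le_of_eq ?_) (EReal.sub_le_sub le_rfl hW)
      simp only [one_mul, EReal.coe_add, sub_eq_add_neg]
      exact add_right_comm _ _ _
end
end
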